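/- There is a universal constant C > 0 such that the following holds. Let G=(V,E,w) be a finite connected weighted graph with shortest-path metric d_G, and let ({X_1,...,X_{k+1}}, {P_1,...,P_k}) be a PSPD of G of depth k with remainder (𝒞, ℬ). Then there exists an embedding f : V → ℓ1 such that: (1) for every u,v ∈ V, ‖f(v) − f(u)‖₁ ≤ C·√k · d_G(u,v); and (2) for every u,v ∈ V such that either u and v do not lie together in a common cluster of 𝒞, or min{d_G(v,ℬ), d_G(u,ℬ)} ≤ d_G(u,v)/12, it holds that ‖f(v) − f(u)‖₁ ≥ d_G(u,v). -/

import Mathlib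

noncomputable section

/-- The space `ℓ₁` of absolutely summable real sequences. -/
abbrev ℓ1 : Type := lp (fun _ : ℕ => ℝ) 1

/-- The weight of a walk: the sum of the weights of its edges. -/
def walkWeight {V : Type*} {G : SimpleGraph V} (w : V → V → ℝ)
    {u v : V} (p : G.Walk u v) : ℝ :=
  (p.darts.map fun d => w d.toProd.1 d.toProd.2).sum

/-- The shortest-path distance between `u` and `v` in the graph `G`
with edge weights `w`. -/
def wdist {V : Type*} (G : SimpleGraph V) (w : V → V → ℝ) (u v : V) : ℝ :=
  sInf {x | ∃ p : G.Walk u v, walkWeight w p = x}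

/-- A connected weighted graph with positive symmetric edge weights. -/
structure WeightedGraph (V : Type*) where
  G : SimpleGraph V
  conn : G.Connected
  w : V → V → ℝ
  w_symm : ∀ u v, w u v = w v u
  w_pos : ∀ u v, G.Adj u v → 0 < w u v

/-- The shortest-path metric of a weighted graph. -/
def WeightedGraph.dist {V : Type*} (W : WeightedGraph V) (u v : V) : ℝ :=
  wdist W.G W.w u v

/-- `P` is the vertex set of a shortest path of the induced subgraph `G[S]`:
there is a walk of `G[S]` which is a path, whose vertex set is `P`, and whose weight
is minimal among all walks of `G[S]` with the same endpoints. -/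
def IsShortestPathIn {V : Type*} (W : WeightedGraph V) (S P : Set V) : Prop :=
  ∃ (a b : S) (p : (W.G.induce S).Walk a b),
    p.IsPath ∧
    P = Subtype.val '' {x : S | x ∈ p.support} ∧
    ∀ q : (W.G.induce S).Walk a b,
      walkWeight (fun x y : S => W.w x y) p ≤ walkWeight (fun x y : S => W.w x y) q

/-- `C` is (the vertex set of) a connected component of the induced subgraph `G[S]`. -/
def IsCompOf {V : Type*} (G : SimpleGraph V) (S C : Set V) : Prop :=
  C ⊆ S ∧ C.Nonempty ∧ (G.induce C).Connected ∧
    ∀ D : Set V, C ⊆ D → D ⊆ S → (G.induce D).Connected → D = C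

/-- A partial shortest path decomposition (PSPD) of depth `k` of the weighted graph `W`:
partial partitions `X 0, …, X k` (representing `X_1, …, X_{k+1}`), where `X 0 = {V}`;
for every `i < k`, to each cluster `S ∈ X i` is associated a (unique) shortest path
`pathOf i S` of `G[S]`, and `X (i+1)` consists of all connected components of
`G[S ∖ pathOf i S]` over all clusters `S ∈ X i`. -/
structure PSPD {V : Type*} (W : WeightedGraph V) (k : ℕ) where
  X : Fin (k + 1) → Set (Set V)
  pathOf : Fin k → Set V → Set V
  X_zero : X 0 = {Set.univ}
  partialPartition : ∀ i : Fin (k + 1), ∀ S ∈ X i, ∀ S' ∈ X i, S ≠ S' → Disjoint S S'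
  path_shortest : ∀ i : Fin k, ∀ S ∈ X i.castSucc, IsShortestPathIn W S (pathOf i S)
  path_subset : ∀ i : Fin k, ∀ S ∈ X i.castSucc, pathOf i S ⊆ S
  X_succ : ∀ i : Fin k,
    X i.succ = {C | ∃ S ∈ X i.castSucc, IsCompOf W.G (S \ pathOf i S) C}

/-- The clusters of the last level of the PSPD. -/
def PSPD.lastClusters {V : Type*} {W : WeightedGraph V} {k : ℕ} (D : PSPD W k) :
    Set (Set V) :=
  D.X (Fin.last k)

/-- The boundary of the PSPD: all vertices lying on some removed path. -/
def PSPD.boundary {V : Type*} {W : WeightedGraph V} {k : ℕ} (D : PSPD W k) : Set V :=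
  ⋃ i : Fin k, ⋃ S ∈ D.X i.castSucc, D.pathOf i S

section GraphLemmas

variable {V : Type} {G : SimpleGraph V} {w : V → V → ℝ}

lemma walkWeight_nil (u : V) : walkWeight w (SimpleGraph.Walk.nil : G.Walk u u) = 0 := by
  simp [walkWeight]

lemma walkWeight_cons {u v x : V} (h : G.Adj u v) (p : G.Walk v x) :
    walkWeight w (SimpleGraph.Walk.cons h p) = w u v + walkWeight w p := by
  simp [walkWeight]

lemma walkWeight_append {u v x : V} (p : G.Walk u v) (q : G.Walk v x) :
    walkWeight w (p.append q) = walkWeight w p + walkWeight w q := by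
  simp [walkWeight]

lemma walkWeight_reverse (hs : ∀ u v, w u v = w v u) {u v : V} (p : G.Walk u v) :
    walkWeight w p.reverse = walkWeight w p := by
  induction p with
  | nil => simp [walkWeight]
  | cons h p ih =>
    rw [SimpleGraph.Walk.reverse_cons, walkWeight_append, ih, walkWeight_cons, walkWeight_cons,
      walkWeight_nil, hs]
    ring

lemma walkWeight_nonneg (hw : ∀ u v, G.Adj u v → 0 < w u v) {u v : V} (p : G.Walk u v) :
    0 ≤ walkWeight w p := by
  induction p with
  | nil => simp [walkWeight]
  | cons h p ih => rw [walkWeight_cons]; linarith [hw _ _ h]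

lemma wdist_le_walkWeight (hw : ∀ u v, G.Adj u v → 0 < w u v) {u v : V} (p : G.Walk u v) :
    wdist G w u v ≤ walkWeight w p := by
  apply csInf_le
  · exact ⟨0, by rintro x ⟨q, rfl⟩; exact walkWeight_nonneg hw q⟩
  · exact ⟨p, rfl⟩

lemma le_wdist (hc : G.Preconnected) {u v : V} {c : ℝ}
    (h : ∀ p : G.Walk u v, c ≤ walkWeight w p) : c ≤ wdist G w u v := by
  obtain ⟨p⟩ := hc u v
  unfold wdist
  refine le_csInf ⟨walkWeight w p, ⟨p, rfl⟩⟩ ?_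
  rintro x ⟨q, rfl⟩
  exact h q

lemma exists_walk_lt (hc : G.Preconnected) {u v : V} {c : ℝ} (h : wdist G w u v < c) :
    ∃ p : G.Walk u v, walkWeight w p < c := by
  by_contra hcon
  push Not at hcon
  exact absurd (le_wdist hc hcon) (not_le.mpr h)

lemma wdist_nonneg (hc : G.Preconnected) (hw : ∀ u v, G.Adj u v → 0 < w u v) (u v : V) :
    0 ≤ wdist G w u v := le_wdist hc fun p => walkWeight_nonneg hw p

lemma wdist_self (hc : G.Preconnected) (hw : ∀ u v, G.Adj u v → 0 < w u v) (u : V) :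
    wdist G w u u = 0 := by
  apply le_antisymm _ (wdist_nonneg hc hw u u)
  have := wdist_le_walkWeight hw (SimpleGraph.Walk.nil : G.Walk u u)
  rwa [walkWeight_nil] at this

lemma wdist_triangle (hc : G.Preconnected) (hw : ∀ u v, G.Adj u v → 0 < w u v) (u v x : V) :
    wdist G w u x ≤ wdist G w u v + wdist G w v x := by
  rw [← sub_le_iff_le_add]
  apply le_wdist hc
  intro q
  rw [sub_le_comm]
  apply le_wdist hc
  intro p
  have := wdist_le_walkWeight hw (q.append p)
  rw [walkWeight_append] at this
  linarith

lemma wdist_comm (hc : G.Preconnected) (hw : ∀ u v, G.Adj u v → 0 < w u v)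
    (hs : ∀ u v, w u v = w v u) (u v : V) : wdist G w u v = wdist G w v u := by
  apply le_antisymm
  · apply le_wdist hc; intro p
    rw [← walkWeight_reverse hs]; exact wdist_le_walkWeight hw _
  · apply le_wdist hc; intro p
    rw [← walkWeight_reverse hs]; exact wdist_le_walkWeight hw _

lemma wdist_le_adj (hw : ∀ u v, G.Adj u v → 0 < w u v) {u v : V} (h : G.Adj u v) :
    wdist G w u v ≤ w u v := by
  have := wdist_le_walkWeight hw (SimpleGraph.Walk.cons h SimpleGraph.Walk.nil)
  rwa [walkWeight_cons, walkWeight_nil, add_zero] at this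

lemma wdist_le_of_mem_support (hw : ∀ u v, G.Adj u v → 0 < w u v) {u v z : V} (p : G.Walk u v)
    (hz : z ∈ p.support) : wdist G w u z ≤ walkWeight w p := by
  classical
  have h := p.take_spec hz
  have h2 := walkWeight_append (w := w) (p.takeUntil z hz) (p.dropUntil z hz)
  rw [h] at h2
  have h3 := wdist_le_walkWeight hw (p.takeUntil z hz)
  have h4 := walkWeight_nonneg hw (p.dropUntil z hz)
  linarith

/-- Edge-Lipschitz to globally Lipschitz. -/
lemma lipschitz_of_edges {E : Type*} [SeminormedAddCommGroup E] (hc : G.Preconnected)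
    (f : V → E) (L : ℝ) (hL : 0 < L)
    (h : ∀ u v, G.Adj u v → ‖f v - f u‖ ≤ L * w u v) (u v : V) :
    ‖f v - f u‖ ≤ L * wdist G w u v := by
  rw [← div_le_iff₀' hL]
  apply le_wdist hc
  intro p
  rw [div_le_iff₀' hL]
  induction p with
  | nil => simp [walkWeight]
  | @cons a b c hab p ih =>
    rw [walkWeight_cons, mul_add]
    have : f c - f a = (f b - f a) + (f c - f b) := by abel
    rw [this]
    exact (norm_add_le _ _).trans (add_le_add (h _ _ hab) ih)

/-- Walk weight of the image of a walk in an induced subgraph. -/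
lemma walkWeight_map_induce (S : Set V) {a b : S} (p : (G.induce S).Walk a b) :
    walkWeight w (p.map (SimpleGraph.Embedding.induce S).toHom) =
      walkWeight (fun x y : S => w x y) p := by
  induction p with
  | nil => simp [walkWeight]
  | cons h p ih =>
    rw [walkWeight_cons, ← ih]
    exact walkWeight_cons _ _

lemma walkWeight_induce (S : Set V) {a b : V} (p : G.Walk a b) (hp : ∀ x ∈ p.support, x ∈ S) :
    walkWeight (fun x y : S => w x y) (p.induce S hp) = walkWeight w p := by
  rw [← walkWeight_map_induce]
  exact congrArg (walkWeight w) (SimpleGraph.Walk.map_induce p hp)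

lemma wdist_le_wdist_induce (hw : ∀ u v, G.Adj u v → 0 < w u v) (S : Set V)
    (hS : (G.induce S).Preconnected) (a b : S) :
    wdist G w a b ≤ wdist (G.induce S) (fun x y : S => w x y) a b := by
  apply le_wdist hS
  intro p
  rw [← walkWeight_map_induce]
  exact wdist_le_walkWeight hw _

lemma pos_split (hc : G.Preconnected) (hw : ∀ u v, G.Adj u v → 0 < w u v) {a b x y : V}
    (q1 : G.Walk a x) (q2 : G.Walk x y) (q3 : G.Walk y b)
    (hmin : ∀ q : G.Walk a b, walkWeight w q1 + walkWeight w q2 + walkWeight w q3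
      ≤ walkWeight w q) :
    wdist G w x y ≤ wdist G w a y - wdist G w a x := by
  have h1 : walkWeight w q1 + walkWeight w q2 ≤ wdist G w a y := by
    apply le_wdist hc
    intro r
    have := hmin (r.append q3)
    rw [walkWeight_append] at this
    linarith
  linarith [wdist_le_walkWeight hw q1, wdist_le_walkWeight hw q2]

lemma pos_on_path (hc : G.Preconnected) (hw : ∀ u v, G.Adj u v → 0 < w u v)
    (hs : ∀ u v, w u v = w v u) {a b x y : V}
    (p : G.Walk a b) (hmin : ∀ q : G.Walk a b, walkWeight w p ≤ walkWeight w q)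
    (hx : x ∈ p.support) (hy : y ∈ p.support) :
    wdist G w x y ≤ |wdist G w a x - wdist G w a y| := by
  classical
  have hsp := p.take_spec hx
  have hy' := hy
  rw [← hsp, SimpleGraph.Walk.mem_support_append_iff] at hy'
  have e1 : walkWeight w p = walkWeight w (p.takeUntil x hx) + walkWeight w (p.dropUntil x hx) := by
    rw [← walkWeight_append, hsp]
  rcases hy' with h | h
  · have e2 := walkWeight_append (w := w) ((p.takeUntil x hx).takeUntil y h)
      ((p.takeUntil x hx).dropUntil y h)
    rw [SimpleGraph.Walk.take_spec] at e2
    have := pos_split hc hw _ _ (p.dropUntil x hx) (fun q => by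
      have := hmin q; rw [e1, e2] at this; exact this)
    rw [wdist_comm hc hw hs]
    exact this.trans (le_abs_self _)
  · have e2 := walkWeight_append (w := w) ((p.dropUntil x hx).takeUntil y h)
      ((p.dropUntil x hx).dropUntil y h)
    rw [SimpleGraph.Walk.take_spec] at e2
    have := pos_split hc hw (p.takeUntil x hx) _ _ (fun q => by
      have := hmin q; rw [e1, e2, ← add_assoc] at this; exact this)
    rw [abs_sub_comm]
    exact this.trans (le_abs_self _)

lemma ciInf_le_ciInf_add {ι : Type*} [Finite ι] [Nonempty ι] (g h : ι → ℝ) (c : ℝ)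
    (H : ∀ i, g i ≤ h i + c) : ⨅ i, g i ≤ (⨅ i, h i) + c := by
  obtain ⟨i, hi⟩ := exists_eq_ciInf_of_finite (f := h)
  rw [← hi]
  exact (ciInf_le (Set.finite_range g).bddBelow i).trans (H i)

end GraphLemmas

/-- Distance to a shortest path and position along it, in a cluster. -/
lemma path_functions {V : Type} [Finite V] (W : WeightedGraph V) (S P : Set V)
    (hS : (W.G.induce S).Preconnected) (hP : IsShortestPathIn W S P) :
    ∃ s pos : V → ℝ, (∀ v, 0 ≤ s v) ∧
      (∀ u ∈ S, ∀ v ∈ S, W.G.Adj u v → |s u - s v| ≤ W.w u v ∧ |pos u - pos v| ≤ W.w u v) ∧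
      (∀ u ∈ S, ∀ b ∈ P, ∀ p : W.G.Walk u b, (∀ x ∈ p.support, x ∈ S) → s u ≤ walkWeight W.w p) ∧
      (∀ u ∈ S, ∀ v ∈ S, W.dist u v - 2 * s u - 2 * s v ≤ |pos u - pos v|) := by
  classical
  obtain ⟨a, b, p, -, rfl, hmin⟩ := hP
  let H := W.G.induce S
  let w : S → S → ℝ := fun x y => W.w x y
  have hw : ∀ u v : S, H.Adj u v → 0 < w u v := fun u v h => W.w_pos u v h
  have hs : ∀ u v : S, w u v = w v u := fun u v => W.w_symm u v
  let Q := {x : S // x ∈ p.support}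
  have : Nonempty Q := ⟨⟨a, p.start_mem_support⟩⟩
  let s0 : S → ℝ := fun u => ⨅ x : Q, wdist H w u x.1
  have s0_lip : ∀ u v : S, s0 u ≤ s0 v + wdist H w u v := fun u v =>
    ciInf_le_ciInf_add _ _ _ fun x => by linarith [wdist_triangle hS hw u v x.1]
  have hcm := wdist_comm hS hw hs
  refine ⟨fun v => if h : v ∈ S then s0 ⟨v, h⟩ else 0,
    fun v => if h : v ∈ S then wdist H w a ⟨v, h⟩ else 0, ?_, ?_, ?_, ?_⟩
  · intro v
    dsimp only
    split_ifs with h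
    · exact le_ciInf fun x => wdist_nonneg hS hw _ _
    · exact le_rfl
  · intro u hu v hv huv
    have h1 : wdist H w ⟨u, hu⟩ ⟨v, hv⟩ ≤ W.w u v := wdist_le_adj (G := H) (w := w) hw huv
    simp only [hu, hv, dif_pos]
    have h2 := s0_lip ⟨u, hu⟩ ⟨v, hv⟩
    have h3 := s0_lip ⟨v, hv⟩ ⟨u, hu⟩
    have h4 := wdist_triangle hS hw a ⟨u, hu⟩ ⟨v, hv⟩
    have h5 := wdist_triangle hS hw a ⟨v, hv⟩ ⟨u, hu⟩
    have h6 := hcm ⟨u, hu⟩ ⟨v, hv⟩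
    constructor <;> rw [abs_le] <;> constructor <;> linarith
  · rintro u hu _ ⟨b', hb', rfl⟩ q hq
    simp only [hu, dif_pos]
    have : s0 ⟨u, hu⟩ ≤ wdist H w ⟨u, hu⟩ b' :=
      ciInf_le (Set.finite_range (fun x : Q => wdist H w ⟨u, hu⟩ x.1)).bddBelow ⟨b', hb'⟩
    refine this.trans ?_
    rw [← walkWeight_induce S q hq]
    exact wdist_le_walkWeight hw _
  · intro u hu v hv
    simp only [hu, hv, dif_pos]
    obtain ⟨x, hx⟩ := exists_eq_ciInf_of_finite (f := fun x : Q => wdist H w ⟨u, hu⟩ x.1)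
    obtain ⟨y, hy⟩ := exists_eq_ciInf_of_finite (f := fun x : Q => wdist H w ⟨v, hv⟩ x.1)
    have hx' : s0 ⟨u, hu⟩ = wdist H w ⟨u, hu⟩ x.1 := hx.symm
    have hy' : s0 ⟨v, hv⟩ = wdist H w ⟨v, hv⟩ y.1 := hy.symm
    have h0 : W.dist u v ≤ wdist H w ⟨u, hu⟩ ⟨v, hv⟩ :=
      wdist_le_wdist_induce W.w_pos S hS ⟨u, hu⟩ ⟨v, hv⟩
    have h1 := pos_on_path hS hw hs p hmin x.2 y.2
    have h2 := wdist_triangle hS hw ⟨u, hu⟩ x.1 ⟨v, hv⟩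
    have h3 := wdist_triangle hS hw x.1 y.1 ⟨v, hv⟩
    have h4 := hcm y.1 ⟨v, hv⟩
    have h5 := hcm x.1 ⟨u, hu⟩
    have t1 := wdist_triangle hS hw a ⟨u, hu⟩ x.1
    have t2 := wdist_triangle hS hw a x.1 ⟨u, hu⟩
    have t3 := wdist_triangle hS hw a ⟨v, hv⟩ y.1
    have t4 := wdist_triangle hS hw a y.1 ⟨v, hv⟩
    rw [hx', hy']
    rcases abs_cases (wdist H w a x.1 - wdist H w a y.1) with ⟨e, _⟩ | ⟨e, _⟩
    · have := le_abs_self (wdist H w a ⟨u, hu⟩ - wdist H w a ⟨v, hv⟩)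
      linarith
    · have := neg_abs_le (wdist H w a ⟨u, hu⟩ - wdist H w a ⟨v, hv⟩)
      linarith

/-- A tent of scale `2^j` in the variable `r`. -/
def tentFn (j : ℤ) (r : ℝ) : ℝ := max 0 ((2:ℝ) ^ j - |r - 3 / 2 * (2:ℝ) ^ j|)

/-- A hat function of width `T` centered at `m * T`. -/
def hatFn (T : ℝ) (m : ℤ) (s : ℝ) : ℝ := max 0 (T - |s - m * T|)

/-- The coordinates attached to one cluster. -/
def coordFn : Option (Option (ℤ × ℤ)) → ℝ → ℝ → ℝ → ℝ
  | none, r, _, _ => r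
  | some none, r, s, _ => min r (s / 3)
  | some (some (j, m)), r, _, p => tentFn j r * (hatFn ((2:ℝ) ^ j) m p / (2:ℝ) ^ j)

lemma abs_max_zero_sub_le (a b : ℝ) : |max 0 a - max 0 b| ≤ |a - b| := by
  simpa using abs_max_sub_max_le_max 0 a 0 b

lemma tentFn_lip (j : ℤ) (r r' : ℝ) : |tentFn j r - tentFn j r'| ≤ |r - r'| := by
  refine (abs_max_zero_sub_le _ _).trans ?_
  have := abs_abs_sub_abs_le_abs_sub (r' - 3 / 2 * (2:ℝ) ^ j) (r - 3 / 2 * (2:ℝ) ^ j)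
  rw [abs_sub_comm r r']
  refine le_trans (le_of_eq ?_) (this.trans (le_of_eq ?_))
  · congr 1; ring
  · congr 1; ring

lemma hatFn_lip (T : ℝ) (m : ℤ) (r r' : ℝ) : |hatFn T m r - hatFn T m r'| ≤ |r - r'| := by
  refine (abs_max_zero_sub_le _ _).trans ?_
  have := abs_abs_sub_abs_le_abs_sub (r' - m * T) (r - m * T)
  rw [abs_sub_comm r r']
  refine le_trans (le_of_eq ?_) (this.trans (le_of_eq ?_))
  · congr 1; ring
  · congr 1; ring

lemma tentFn_nonneg (j : ℤ) (r : ℝ) : 0 ≤ tentFn j r := le_max_left _ _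
lemma hatFn_nonneg (T : ℝ) (m : ℤ) (r : ℝ) : 0 ≤ hatFn T m r := le_max_left _ _
lemma tentFn_le (j : ℤ) (r : ℝ) : tentFn j r ≤ (2:ℝ) ^ j :=
  max_le (by positivity) (by linarith [abs_nonneg (r - 3 / 2 * (2:ℝ) ^ j)])
lemma hatFn_le (T : ℝ) (hT : 0 ≤ T) (m : ℤ) (r : ℝ) : hatFn T m r ≤ T :=
  max_le hT (by linarith [abs_nonneg (r - m * T)])

lemma prod_lip {T a b a' b' : ℝ} (hT : 0 < T) (ha : 0 ≤ a) (haT : a ≤ T) (hb' : 0 ≤ b')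
    (hbT : b' ≤ T) : |a * (b / T) - a' * (b' / T)| ≤ |a - a'| + |b - b'| := by
  have e : a * (b / T) - a' * (b' / T) = a / T * (b - b') + (a - a') * (b' / T) := by
    field_simp; ring
  rw [e]
  refine (abs_add_le _ _).trans ?_
  rw [abs_mul, abs_mul, abs_of_nonneg (by positivity : 0 ≤ a / T),
    abs_of_nonneg (by positivity : 0 ≤ b' / T)]
  have h1 : a / T ≤ 1 := (div_le_one hT).mpr haT
  have h2 : b' / T ≤ 1 := (div_le_one hT).mpr hbT
  nlinarith [abs_nonneg (b - b'), abs_nonneg (a - a')]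

lemma coordFn_lip (t : Option (Option (ℤ × ℤ))) (r s p r' s' p' : ℝ) :
    |coordFn t r s p - coordFn t r' s' p'| ≤ |r - r'| + |s - s'| + |p - p'| := by
  have h1 := abs_nonneg (r - r')
  have h2 := abs_nonneg (s - s')
  have h3 := abs_nonneg (p - p')
  match t with
  | none => simp only [coordFn]; linarith
  | some none =>
    simp only [coordFn]
    refine (abs_min_sub_min_le_max _ _ _ _).trans ?_
    apply max_le
    · linarith
    · rw [← sub_div, abs_div]
      have : |(3:ℝ)| = 3 := by norm_num
      rw [this]; linarith
  | some (some (j, m)) =>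
    simp only [coordFn]
    have hT : (0:ℝ) < (2:ℝ) ^ j := by positivity
    have := prod_lip (b := hatFn ((2:ℝ) ^ j) m p) (a' := tentFn j r') hT (tentFn_nonneg j r)
      (tentFn_le j r) (hatFn_nonneg ((2:ℝ) ^ j) m p') (hatFn_le _ hT.le m p')
    linarith [tentFn_lip j r r', hatFn_lip ((2:ℝ) ^ j) m p p']

lemma coordFn_zero (t : Option (Option (ℤ × ℤ))) (s p : ℝ) (hs : 0 ≤ s) :
    coordFn t 0 s p = 0 := by
  match t with
  | none => rfl
  | some none => simp only [coordFn]; exact min_eq_left (by positivity)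
  | some (some (j, m)) =>
    simp only [coordFn]
    have : tentFn j 0 = 0 := by
      apply max_eq_left
      have hT : (0:ℝ) < (2:ℝ) ^ j := by positivity
      rw [zero_sub, abs_neg, abs_of_pos (by positivity)]
      linarith
    rw [this, zero_mul]

lemma tentFn_support {j : ℤ} {r : ℝ} (h : tentFn j r ≠ 0) :
    0 < r ∧ (Int.log 2 r = j - 1 ∨ Int.log 2 r = j ∨ Int.log 2 r = j + 1) := by
  have hT : (0:ℝ) < (2:ℝ) ^ j := by positivity
  have h0 : 0 < (2:ℝ) ^ j - |r - 3 / 2 * (2:ℝ) ^ j| := by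
    by_contra hc
    exact h (max_eq_left (not_lt.mp hc))
  have h1 : |r - 3 / 2 * (2:ℝ) ^ j| < (2:ℝ) ^ j := by linarith
  rw [abs_lt] at h1
  have hr : 0 < r := by linarith
  refine ⟨hr, ?_⟩
  have e1 : (2:ℝ) ^ (j - 1) ≤ r := by
    rw [zpow_sub_one₀ (by norm_num)]; linarith
  have e2 : r < (2:ℝ) ^ (j + 2) := by
    rw [zpow_add₀ (by norm_num)]; norm_num; linarith
  have f1 := (Int.zpow_le_iff_le_log (R := ℝ) (b := 2) (by norm_num) hr (x := j - 1)).mp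
    (by exact_mod_cast e1)
  have f2 := (Int.lt_zpow_iff_log_lt (R := ℝ) (b := 2) (by norm_num) hr (x := j + 2)).mp
    (by exact_mod_cast e2)
  omega

lemma hatFn_support {T : ℝ} (hT : 0 < T) {m : ℤ} {s : ℝ} (h : hatFn T m s ≠ 0) :
    m = ⌊s / T⌋ ∨ m = ⌊s / T⌋ + 1 := by
  have h0 : 0 < T - |s - m * T| := by
    by_contra hc
    exact h (max_eq_left (not_lt.mp hc))
  have h1 : |s - m * T| < T := by linarith
  rw [abs_lt] at h1
  have e : s = s / T * T := by field_simp
  have a1 : (m : ℝ) - 1 < s / T := by rw [lt_div_iff₀ hT]; linarith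
  have a2 : s / T < (m : ℝ) + 1 := by rw [div_lt_iff₀ hT]; linarith
  have b1 : m - 1 ≤ ⌊s / T⌋ := by rw [Int.le_floor]; push_cast; exact a1.le
  have b2 : ⌊s / T⌋ < m + 1 := by rw [Int.floor_lt]; push_cast; exact a2
  omega

/-- At each point at most eight coordinates are nonzero. -/
lemma coordFn_support (r s p : ℝ) : ∃ B : Finset (Option (Option (ℤ × ℤ))), B.card ≤ 8 ∧
    ∀ t, t ∉ B → coordFn t r s p = 0 := by
  classical
  let l := Int.log 2 r
  let fl : ℤ → ℤ := fun j => ⌊p / (2:ℝ) ^ j⌋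
  refine ⟨{none, some none, some (some (l - 1, fl (l - 1))), some (some (l - 1, fl (l - 1) + 1)),
    some (some (l, fl l)), some (some (l, fl l + 1)),
    some (some (l + 1, fl (l + 1))), some (some (l + 1, fl (l + 1) + 1))}, (Finset.card_insert_le _ _).trans
      (Nat.succ_le_succ ((Finset.card_insert_le _ _).trans (Nat.succ_le_succ Finset.card_le_six))), ?_⟩
  intro t ht
  match t with
  | none => simp at ht
  | some none => simp at ht
  | some (some (j, m)) =>
    by_contra hne
    simp only [coordFn] at hne
    have h1 : tentFn j r ≠ 0 := left_ne_zero_of_mul hne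
    have h2 : hatFn ((2:ℝ) ^ j) m p ≠ 0 := fun h => hne (by rw [h]; simp)
    obtain ⟨-, h3⟩ := tentFn_support h1
    have h4 := hatFn_support (by positivity) h2
    apply ht
    rcases h3 with h3 | h3 | h3
    · obtain rfl : j = l + 1 := by simp only [l]; omega
      rcases h4 with h4 | h4 <;> subst h4 <;> simp [fl]
    · obtain rfl : j = l := by simp only [l]; omega
      rcases h4 with h4 | h4 <;> subst h4 <;> simp [fl]
    · obtain rfl : j = l - 1 := by simp only [l]; omega
      rcases h4 with h4 | h4 <;> subst h4 <;> simp [fl]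

lemma hatFn_sep_aux {T : ℝ} (hT : 0 < T) (s s' : ℝ) (hss : s ≤ s') :
    ∃ m : ℤ, min (s' - s) T / 2 ≤ |hatFn T m s - hatFn T m s'| := by
  set m := ⌊s / T⌋ with hm
  have m1 : (m:ℝ) * T ≤ s := by rw [← le_div_iff₀ hT]; exact Int.floor_le _
  have m2 : s < ((m:ℝ) + 1) * T := by rw [← div_lt_iff₀ hT]; exact Int.lt_floor_add_one _
  have v0 : hatFn T m s = (m + 1) * T - s := by
    unfold hatFn; rw [abs_of_nonneg (by linarith), max_eq_right (by linarith)]; ring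
  have v1 : hatFn T (m + 1) s = s - m * T := by
    unfold hatFn; push_cast
    rw [abs_of_nonpos (by linarith), max_eq_right (by linarith)]; ring
  have v2 : hatFn T (m + 2) s = 0 := by
    unfold hatFn; push_cast
    rw [abs_of_nonpos (by linarith), max_eq_left (by linarith)]
  by_cases c1 : s' ≤ (m + 1) * T
  · have w0 : hatFn T m s' = (m + 1) * T - s' := by
      unfold hatFn; rw [abs_of_nonneg (by linarith), max_eq_right (by linarith)]; ring
    refine ⟨m, ?_⟩
    rw [v0, w0]
    have := min_le_left (s' - s) T
    have := le_abs_self ((m + 1) * T - s - ((m + 1) * T - s'))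
    linarith
  push Not at c1
  have w0 : hatFn T m s' = 0 := by
    unfold hatFn; rw [abs_of_nonneg (by linarith), max_eq_left (by linarith)]
  by_cases c2 : s' ≤ (m + 2) * T
  · have w2 : hatFn T (m + 2) s' = s' - (m + 1) * T := by
      unfold hatFn; push_cast
      rw [abs_of_nonpos (by linarith), max_eq_right (by linarith)]; ring
    have := min_le_left (s' - s) T
    by_cases c3 : (s' - s) / 2 ≤ (m + 1) * T - s
    · refine ⟨m, ?_⟩
      rw [v0, w0]
      have := le_abs_self ((m + 1) * T - s - 0)
      linarith
    · refine ⟨m + 2, ?_⟩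
      rw [v2, w2]
      have := neg_abs_le (0 - (s' - (m + 1) * T))
      linarith
  · push Not at c2
    have w1 : hatFn T (m + 1) s' = 0 := by
      unfold hatFn; push_cast
      rw [abs_of_nonneg (by linarith), max_eq_left (by linarith)]
    have := min_le_right (s' - s) T
    by_cases c3 : T / 2 ≤ (m + 1) * T - s
    · refine ⟨m, ?_⟩
      rw [v0, w0]
      have := le_abs_self ((m + 1) * T - s - 0)
      linarith
    · refine ⟨m + 1, ?_⟩
      rw [v1, w1]
      have := le_abs_self (s - m * T - 0)
      linarith

lemma hatFn_sep {T : ℝ} (hT : 0 < T) (s s' : ℝ) :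
    ∃ m : ℤ, min |s - s'| T / 2 ≤ |hatFn T m s - hatFn T m s'| := by
  rcases le_total s s' with h | h
  · rw [abs_sub_comm s s', abs_of_nonneg (sub_nonneg.mpr h)]
    exact hatFn_sep_aux hT s s' h
  · rw [abs_of_nonneg (sub_nonneg.mpr h)]
    obtain ⟨m, hm⟩ := hatFn_sep_aux hT s' s h
    exact ⟨m, by rwa [abs_sub_comm (hatFn T m s)]⟩

lemma coordFn_lower {δ r r' s s' p p' : ℝ} (hδ : 0 < δ) (hr : δ < r) (hr' : δ < r')
    (hs : s ≤ δ) (hp : 12 * δ - 2 * s - 2 * s' ≤ |p - p'|) :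
    ∃ t, δ / 16 ≤ |coordFn t r s p - coordFn t r' s' p'| := by
  by_cases h1 : 2 * δ ≤ s'
  · refine ⟨some none, ?_⟩
    simp only [coordFn]
    have a1 : min r (s / 3) ≤ δ / 3 := (min_le_right _ _).trans (by linarith)
    have a2 : 2 * δ / 3 ≤ min r' (s' / 3) := le_min (by linarith) (by linarith)
    have := neg_abs_le (min r (s / 3) - min r' (s' / 3))
    linarith
  push Not at h1
  by_cases h2 : δ / 16 ≤ |r - r'|
  · exact ⟨none, h2⟩
  push Not at h2
  have hr0 : 0 < r := hδ.trans hr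
  set j := Int.log 2 r with hj
  have l1 : (2:ℝ) ^ j ≤ r := by
    have := Int.zpow_log_le_self (R := ℝ) (b := 2) (by norm_num) hr0
    exact_mod_cast this
  have l2 : r < 2 * (2:ℝ) ^ j := by
    have := Int.lt_zpow_succ_log_self (R := ℝ) (b := 2) (by norm_num) r
    rw [← hj, zpow_add_one₀ (by norm_num)] at this
    push_cast at this
    linarith
  set T := (2:ℝ) ^ j with hTdef
  have hT : 0 < T := by positivity
  obtain ⟨m, hm⟩ := hatFn_sep hT p p'
  refine ⟨some (some (j, m)), ?_⟩
  simp only [coordFn]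
  rw [← hTdef]
  have hmin : δ / 2 ≤ min |p - p'| T := le_min (by linarith) (by linarith)
  have hta : T / 2 ≤ tentFn j r := by
    unfold tentFn
    refine le_trans ?_ (le_max_right _ _)
    rw [← hTdef]
    have : |r - 3 / 2 * T| ≤ T / 2 := by rw [abs_le]; constructor <;> linarith
    linarith
  set A := tentFn j r
  set A' := tentFn j r'
  set b := hatFn T m p
  set b' := hatFn T m p'
  have hA : |A - A'| ≤ |r - r'| := tentFn_lip j r r'
  have hb0 : 0 ≤ b' := hatFn_nonneg _ _ _
  have hbT : b' ≤ T := hatFn_le T hT.le _ _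
  have e : A / T * (b - b') = (A * (b / T) - A' * (b' / T)) - (A - A') * (b' / T) := by
    field_simp; ring
  have h3 : |A / T * (b - b')| ≤ |A * (b / T) - A' * (b' / T)| + |A - A'| := by
    rw [e]
    refine (abs_sub _ _).trans ?_
    have : |(A - A') * (b' / T)| ≤ |A - A'| := by
      rw [abs_mul, abs_of_nonneg (by positivity : 0 ≤ b' / T)]
      exact mul_le_of_le_one_right (abs_nonneg _) ((div_le_one hT).mpr hbT)
    linarith
  have hAT : 1 / 2 ≤ A / T := by rw [le_div_iff₀ hT]; linarith
  have h4 : δ / 8 ≤ |A / T * (b - b')| := by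
    rw [abs_mul, abs_of_nonneg (by linarith : 0 ≤ A / T)]
    nlinarith [abs_nonneg (b - b')]
  linarith

section Clusters

variable {V : Type} {W : WeightedGraph V} {k : ℕ}

lemma WeightedGraph.pre (W : WeightedGraph V) : W.G.Preconnected := W.conn.preconnected

lemma WeightedGraph.dist_self' (W : WeightedGraph V) (u : V) : W.dist u u = 0 :=
  wdist_self W.pre W.w_pos u

lemma WeightedGraph.dist_nonneg' (W : WeightedGraph V) (u v : V) : 0 ≤ W.dist u v :=
  wdist_nonneg W.pre W.w_pos u v

lemma WeightedGraph.dist_comm' (W : WeightedGraph V) (u v : V) : W.dist u v = W.dist v u :=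
  wdist_comm W.pre W.w_pos W.w_symm u v

lemma WeightedGraph.dist_triangle' (W : WeightedGraph V) (u v x : V) :
    W.dist u x ≤ W.dist u v + W.dist v x :=
  wdist_triangle W.pre W.w_pos u v x

lemma WeightedGraph.dist_le_adj (W : WeightedGraph V) {u v : V} (h : W.G.Adj u v) :
    W.dist u v ≤ W.w u v :=
  wdist_le_adj W.w_pos h

/-- Boundary vertices on the paths removed before level `i`. -/
def PSPD.below (D : PSPD W k) (i : Fin (k + 1)) : Set V :=
  {b | ∃ j : Fin k, j.castSucc < i ∧ ∃ S ∈ D.X j.castSucc, b ∈ D.pathOf j S}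

lemma PSPD.below_mono (D : PSPD W k) (i : Fin k) : D.below i.castSucc ⊆ D.below i.succ := by
  rintro b ⟨j, hj, h⟩
  exact ⟨j, hj.trans (Fin.castSucc_lt_succ), h⟩

lemma PSPD.mem_below_succ (D : PSPD W k) (i : Fin k) {S : Set V} (hS : S ∈ D.X i.castSucc) {b : V}
    (hb : b ∈ D.pathOf i S) : b ∈ D.below i.succ :=
  ⟨i, Fin.castSucc_lt_succ, S, hS, hb⟩

lemma PSPD.cluster_connected (D : PSPD W k) (i : Fin (k + 1)) {S : Set V} (hS : S ∈ D.X i) :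
    (W.G.induce S).Connected := by
  revert hS
  refine Fin.cases ?_ ?_ i
  · intro hS
    rw [D.X_zero] at hS
    obtain rfl : S = Set.univ := hS
    exact (SimpleGraph.induceUnivIso W.G).connected_iff.mpr W.conn
  · intro i hS
    rw [D.X_succ] at hS
    obtain ⟨S', _, h⟩ := hS
    exact h.2.2.1

lemma exists_comp [Finite V] (G : SimpleGraph V) (S : Set V) (u : V) (hu : u ∈ S) :
    ∃ C, IsCompOf G S C ∧ u ∈ C := by
  let A : Set (Set V) := {C | u ∈ C ∧ C ⊆ S ∧ (G.induce C).Connected}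
  have h0 : ({u} : Set V) ∈ A := by
    refine ⟨rfl, by simpa using hu, ?_⟩
    have : Nonempty ({u} : Set V) := ⟨⟨u, rfl⟩⟩
    exact ⟨SimpleGraph.Preconnected.of_subsingleton⟩
  obtain ⟨C, hC⟩ := (Set.toFinite A).exists_maximal ⟨_, h0⟩
  refine ⟨C, ⟨hC.1.2.1, ⟨u, hC.1.1⟩, hC.1.2.2, ?_⟩, hC.1.1⟩
  intro D hCD hDS hD
  exact Set.Subset.antisymm (hC.2 ⟨hCD hC.1.1, hDS, hD⟩ hCD) hCD

lemma PSPD.exists_cluster [Finite V] (D : PSPD W k) (i : Fin (k + 1)) (u : V)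
    (hu : u ∉ D.below i) : ∃ S ∈ D.X i, u ∈ S := by
  revert hu
  refine Fin.induction ?_ ?_ i
  · intro _
    exact ⟨Set.univ, by rw [D.X_zero]; rfl, trivial⟩
  · intro i ih hu
    obtain ⟨S, hS, huS⟩ := ih fun h => hu (D.below_mono i h)
    obtain ⟨C, hC, huC⟩ := exists_comp W.G (S \ D.pathOf i S) u
      ⟨huS, fun h => hu (D.mem_below_succ i hS h)⟩
    exact ⟨C, by rw [D.X_succ]; exact ⟨S, hS, hC⟩, huC⟩

lemma PSPD.leave_mem_below (D : PSPD W k) (i : Fin (k + 1)) : ∀ S ∈ D.X i, ∀ x ∈ S, ∀ y ∉ S,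
    W.G.Adj x y → y ∈ D.below i := by
  refine Fin.induction ?_ ?_ i
  · intro S hS x _ y hy _
    rw [D.X_zero] at hS
    obtain rfl : S = Set.univ := hS
    exact absurd trivial hy
  · intro i ih C hC x hx y hy hxy
    rw [D.X_succ] at hC
    obtain ⟨S, hS, hCS, _, hconn, hmax⟩ := hC
    by_cases h1 : y ∈ S
    · by_cases h2 : y ∈ D.pathOf i S
      · exact D.mem_below_succ i hS h2
      · exfalso
        have hc : (W.G.induce (C ∪ {x, y})).Connected :=
          SimpleGraph.induce_union_connected hconn.preconnected
            (SimpleGraph.induce_pair_connected_of_adj hxy).preconnected ⟨x, hx, by simp⟩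
        have := hmax (C ∪ {x, y}) Set.subset_union_left (by
          intro z hz
          rcases hz with hz | rfl | rfl
          · exact hCS hz
          · exact hCS hx
          · exact ⟨h1, h2⟩) hc
        apply hy
        rw [← this]
        right; right; rfl
    · exact D.below_mono i (ih S hS x (hCS hx).1 y h1 hxy)

lemma PSPD.walk_leaves (D : PSPD W k) (i : Fin (k + 1)) {S : Set V} (hS : S ∈ D.X i) {u z : V}
    (p : W.G.Walk u z) (hu : u ∈ S) (hz : z ∉ S) : ∃ b ∈ D.below i, b ∈ p.support := by
  induction p with
  | nil => exact absurd hu hz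
  | @cons a b c hab p ih =>
    by_cases hb : b ∈ S
    · obtain ⟨y, hy, hy'⟩ := ih hb hz
      exact ⟨y, hy, by simp [hy']⟩
    · exact ⟨b, D.leave_mem_below i S hS a hu b hb hab, by simp⟩

lemma PSPD.dist_outside [Finite V] (D : PSPD W k) (i : Fin (k + 1)) {S : Set V} (hS : S ∈ D.X i)
    {u z : V} (hu : u ∈ S) (hz : z ∉ S) {δ : ℝ} (hδ : ∀ b ∈ D.below i, δ < W.dist u b) :
    δ < W.dist u z := by
  obtain ⟨p⟩ := W.pre u z
  obtain ⟨b0, hb0, _⟩ := D.walk_leaves i hS p hu hz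
  obtain ⟨b, hb, hmin⟩ := Set.exists_min_image (D.below i) (W.dist u) (Set.toFinite _) ⟨b0, hb0⟩
  refine (hδ b hb).trans_le (le_wdist W.pre fun q => ?_)
  obtain ⟨y, hy, hyq⟩ := D.walk_leaves i hS q hu hz
  exact (hmin y hy).trans (wdist_le_of_mem_support W.w_pos q hyq)

open Classical in
/-- Distance to the complement of `S`, truncated at `R`. -/
def rhoFn (W : WeightedGraph V) (R : ℝ) (S : Set V) (v : V) : ℝ :=
  ⨅ z, if z ∈ S then R else W.dist v z

lemma rhoFn_lip [Finite V] {R : ℝ} {S : Set V} {u v : V} (h : W.G.Adj u v) :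
    |rhoFn W R S u - rhoFn W R S v| ≤ W.w u v := by
  classical
  have := W.conn.nonempty
  have h1 := W.dist_le_adj h
  have hw := W.w_pos u v h
  have a1 : rhoFn W R S u ≤ rhoFn W R S v + W.w u v := by
    apply ciInf_le_ciInf_add
    intro z
    split_ifs
    · linarith
    · linarith [W.dist_triangle' u v z]
  have a2 : rhoFn W R S v ≤ rhoFn W R S u + W.w u v := by
    apply ciInf_le_ciInf_add
    intro z
    split_ifs
    · linarith
    · linarith [W.dist_triangle' v u z, W.dist_comm' u v]
  rw [abs_le]
  constructor <;> linarith

lemma rhoFn_zero [Finite V] {R : ℝ} (hR : 0 ≤ R) {S : Set V} {v : V} (hv : v ∉ S) :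
    rhoFn W R S v = 0 := by
  classical
  have := W.conn.nonempty
  apply le_antisymm
  · have := ciInf_le (Set.finite_range (fun z => if z ∈ S then R else W.dist v z)).bddBelow v
    simp only [hv, if_false, W.dist_self'] at this
    unfold rhoFn
    convert this
  · apply le_ciInf
    intro z
    split_ifs
    · exact hR
    · exact W.dist_nonneg' v z

lemma lt_rhoFn [Finite V] {R δ : ℝ} (hR : δ < R) {S : Set V} {v : V}
    (h : ∀ z ∉ S, δ < W.dist v z) : δ < rhoFn W R S v := by
  classical
  have := W.conn.nonempty
  obtain ⟨z, hz⟩ := exists_eq_ciInf_of_finite (f := fun z => if z ∈ S then R else W.dist v z)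
  have : rhoFn W R S v = if z ∈ S then R else W.dist v z := by
    unfold rhoFn
    rw [hz]
  rw [this]
  split_ifs with hzS
  · exact hR
  · exact h z hzS

end Clusters

/-- Randomised signs: the finite family of linear forms mapping `ℓ₂` into `ℓ₁`. -/
lemma sign_forms {ι : Type*} [DecidableEq ι] (A : Finset ι) :
    ∃ (N : ℕ) (L : Fin N → (ι → ℝ) →ₗ[ℝ] ℝ), 0 < N ∧
      (∀ x, ∑ n, (L n x) ^ 2 = N * ∑ a ∈ A, (x a) ^ 2) ∧
      (∀ x, ∀ a ∈ A, N * |x a| ≤ ∑ n, |L n x|) := by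
  induction A using Finset.induction_on with
  | empty => exact ⟨1, fun _ => 0, one_pos, by simp, by simp⟩
  | @insert b A hb ih =>
    obtain ⟨N, L, hN, h1, h2⟩ := ih
    let pr : (ι → ℝ) →ₗ[ℝ] ℝ := LinearMap.proj b
    refine ⟨N + N, Fin.append (fun n => L n + pr) (fun n => L n - pr), by omega, ?_, ?_⟩
    · intro x
      rw [Fin.sum_univ_add]
      simp only [Fin.append_left, Fin.append_right]
      rw [← Finset.sum_add_distrib, Finset.sum_insert hb]
      have : ∀ n, ((L n + pr) x) ^ 2 + ((L n - pr) x) ^ 2 = 2 * (L n x) ^ 2 + 2 * (x b) ^ 2 := by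
        intro n
        simp only [LinearMap.add_apply, LinearMap.sub_apply, pr, LinearMap.proj_apply]
        ring
      simp only [this]
      rw [Finset.sum_add_distrib, ← Finset.mul_sum, h1]
      simp
      ring
    · intro x a ha
      rw [Fin.sum_univ_add]
      simp only [Fin.append_left, Fin.append_right]
      rw [← Finset.sum_add_distrib]
      have e : ∀ n, |(L n + pr) x| + |(L n - pr) x| = |L n x + x b| + |L n x - x b| := by
        intro n; rfl
      simp only [e]
      rcases Finset.mem_insert.mp ha with rfl | ha
      · have : ∀ n ∈ Finset.univ, 2 * |x a| ≤ |L n x + x a| + |L n x - x a| := by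
          intro n _
          have h := abs_sub (L n x + x a) (L n x - x a)
          have e2 : L n x + x a - (L n x - x a) = 2 * x a := by ring
          rw [e2, abs_mul, abs_two] at h
          exact h
        have := Finset.sum_le_sum this
        simp only [Finset.sum_const, Finset.card_univ, Fintype.card_fin, nsmul_eq_mul] at this
        push_cast
        linarith
      · have : ∀ n ∈ Finset.univ, 2 * |L n x| ≤ |L n x + x b| + |L n x - x b| := by
          intro n _
          have h := abs_add_le (L n x + x b) (L n x - x b)
          have e2 : L n x + x b + (L n x - x b) = 2 * L n x := by ring
          rw [e2, abs_mul, abs_two] at h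
          exact h
        have := Finset.sum_le_sum this
        rw [← Finset.mul_sum] at this
        have := h2 x a ha
        push_cast
        linarith

/-- A finite vector as an element of `ℓ₁`. -/
lemma exists_l1 (N : ℕ) : ∃ T : (Fin N → ℝ) → ℓ1, ∀ x y, ‖T x - T y‖ = ∑ n, |x n - y n| := by
  let e : (Fin N → ℝ) → ℕ → ℝ := fun x n => if h : n < N then x ⟨n, h⟩ else 0
  have he : ∀ x, ∀ n ∉ Finset.range N, e x n = 0 := by
    intro x n hn
    simp only [Finset.mem_range] at hn
    simp [e, hn]
  have hmem : ∀ x, Memℓp (E := fun _ : ℕ => ℝ) (e x) 1 := by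
    intro x
    apply memℓp_gen
    apply summable_of_ne_finset_zero (s := Finset.range N)
    intro n hn
    rw [he x n hn]
    simp
  refine ⟨fun x => ⟨e x, hmem x⟩, fun x y => ?_⟩
  rw [lp.norm_eq_tsum_rpow (by simp)]
  simp only [ENNReal.toReal_one, Real.rpow_one, div_one]
  rw [tsum_eq_sum (s := Finset.range N), Finset.sum_range]
  · apply Finset.sum_congr rfl
    intro n _
    change ‖e x n - e y n‖ = _
    simp [e, Real.norm_eq_abs]
  · intro n hn
    change ‖e x n - e y n‖ = _
    rw [he x n hn, he y n hn]; simp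

/-- From coordinates to an embedding into `ℓ₁`. -/
lemma embed_l1 {V ι : Type} (F : V → ι → ℝ) (A : Finset ι) :
    ∃ f : V → ℓ1, (∀ u v, ‖f v - f u‖ ^ 2 ≤ ∑ a ∈ A, (F v a - F u a) ^ 2) ∧
      (∀ u v, ∀ a ∈ A, |F v a - F u a| ≤ ‖f v - f u‖) := by
  classical
  obtain ⟨N, L, hN, h1, h2⟩ := sign_forms A
  obtain ⟨T, hT⟩ := exists_l1 N
  have hN' : (0:ℝ) < N := by exact_mod_cast hN
  have key : ∀ u v, ‖T (fun n => L n (F v) / N) - T (fun n => L n (F u) / N)‖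
      = (∑ n, |L n (F v - F u)|) / N := by
    intro u v
    rw [hT, Finset.sum_div]
    apply Finset.sum_congr rfl
    intro n _
    rw [← sub_div, abs_div, map_sub, abs_of_pos hN']
  refine ⟨fun v => T (fun n => L n (F v) / N), ?_, ?_⟩
  · intro u v
    rw [key, div_pow, div_le_iff₀ (by positivity)]
    have := sq_sum_le_card_mul_sum_sq (s := (Finset.univ : Finset (Fin N)))
      (f := fun n => |L n (F v - F u)|)
    simp only [sq_abs, Finset.card_univ, Fintype.card_fin, h1] at this
    refine this.trans (le_of_eq ?_)
    simp only [Pi.sub_apply]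
    ring
  · intro u v a ha
    rw [key, le_div_iff₀ hN']
    have := h2 (F v - F u) a ha
    simp only [Pi.sub_apply] at this
    linarith

lemma PSPD.cluster_data {V : Type} [Finite V] {W : WeightedGraph V} {k : ℕ} (D : PSPD W k)
    (i : Fin (k + 1)) (S : Set V) : ∃ s pos : V → ℝ, (∀ v, 0 ≤ s v) ∧ (S ∈ D.X i →
      (∀ u ∈ S, ∀ v ∈ S, W.G.Adj u v → |s u - s v| ≤ W.w u v ∧ |pos u - pos v| ≤ W.w u v) ∧
      ∀ j : Fin k, j.castSucc = i →
      (∀ u ∈ S, ∀ b ∈ D.pathOf j S, ∀ p : W.G.Walk u b, (∀ x ∈ p.support, x ∈ S) →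
        s u ≤ walkWeight W.w p) ∧
      (∀ u ∈ S, ∀ v ∈ S, W.dist u v - 2 * s u - 2 * s v ≤ |pos u - pos v|)) := by
  by_cases h : S ∈ D.X i ∧ ∃ j : Fin k, j.castSucc = i
  · obtain ⟨hS, j, rfl⟩ := h
    obtain ⟨s, pos, h1, h2, h3⟩ := path_functions W S (D.pathOf j S)
      (D.cluster_connected _ hS).preconnected (D.path_shortest j S hS)
    refine ⟨s, pos, h1, fun _ => ⟨h2, fun j' hj' => ?_⟩⟩
    obtain rfl := Fin.castSucc_injective k hj'
    exact h3
  · refine ⟨fun _ => 0, fun _ => 0, fun _ => le_rfl, fun hS => ⟨?_, ?_⟩⟩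
    · intro u _ v _ huv
      simp [(W.w_pos u v huv).le]
    · intro j hj
      exact absurd ⟨hS, j, hj⟩ h

lemma PSPD.core {V : Type} [Finite V] {W : WeightedGraph V} {k : ℕ} (D : PSPD W k) :
    ∃ (ι : Type) (F : V → ι → ℝ),
      (∀ u v, W.G.Adj u v → ∀ a, |F u a - F v a| ≤ 3 * W.w u v) ∧
      (∀ u, ∃ B : Finset ι, B.card ≤ (k + 1) * 8 ∧ ∀ a ∉ B, F u a = 0) ∧
      (∀ u v, 0 < W.dist u v →
        ((¬ ∃ S ∈ D.lastClusters, u ∈ S ∧ v ∈ S) ∨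
              (∃ b ∈ D.boundary,
                W.dist v b ≤ W.dist u v / 12 ∨ W.dist u b ≤ W.dist u v / 12)) →
        ∃ a, W.dist u v / 192 ≤ |F u a - F v a|) := by
  classical
  choose s pos hs0 hsp using D.cluster_data
  obtain ⟨R, hR⟩ : ∃ R : ℝ, ∀ u v, W.dist u v ≤ R := by
    obtain ⟨R, hR⟩ := (Set.finite_range (fun x : V × V => W.dist x.1 x.2)).bddAbove
    exact ⟨R, fun u v => hR ⟨(u, v), rfl⟩⟩
  have hR0 : 0 ≤ R := by
    obtain ⟨u⟩ := W.conn.nonempty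
    exact (W.dist_nonneg' u u).trans (hR u u)
  let F : V → Fin (k + 1) × Set V × Option (Option (ℤ × ℤ)) → ℝ := fun v a =>
    if a.2.1 ∈ D.X a.1 then
      coordFn a.2.2 (rhoFn W R a.2.1 v) (s a.1 a.2.1 v) (pos a.1 a.2.1 v) else 0
  have hF0 : ∀ v i S t, v ∉ S → F v (i, S, t) = 0 := by
    intro v i S t hv
    simp only [F]
    split_ifs
    · rw [rhoFn_zero hR0 hv, coordFn_zero _ _ _ (hs0 i S v)]
    · rfl
  have hFin : ∀ v i S t, S ∈ D.X i → F v (i, S, t) =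
      coordFn t (rhoFn W R S v) (s i S v) (pos i S v) := by
    intro v i S t hS
    simp only [F, hS, if_true]
  -- one endpoint outside
  have hedge : ∀ u v, W.G.Adj u v → ∀ i S t, S ∈ D.X i → u ∉ S →
      |F u (i, S, t) - F v (i, S, t)| ≤ W.w u v := by
    intro u v huv i S t hS hu
    rw [hF0 u i S t hu, hFin v i S t hS]
    have h1 := coordFn_lip t 0 (s i S v) (pos i S v) (rhoFn W R S v) (s i S v) (pos i S v)
    rw [coordFn_zero _ _ _ (hs0 i S v)] at h1
    have h2 := rhoFn_lip (R := R) (S := S) huv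
    rw [rhoFn_zero hR0 hu] at h2
    simp only [sub_self, abs_zero, add_zero] at h1
    exact h1.trans h2
  refine ⟨_, F, ?_, ?_, ?_⟩
  · rintro u v huv ⟨i, S, t⟩
    have hw := W.w_pos u v huv
    by_cases hS : S ∈ D.X i
    · by_cases hu : u ∈ S
      · by_cases hv : v ∈ S
        · rw [hFin u i S t hS, hFin v i S t hS]
          have h1 := coordFn_lip t (rhoFn W R S u) (s i S u) (pos i S u)
            (rhoFn W R S v) (s i S v) (pos i S v)
          have h2 := rhoFn_lip (R := R) (S := S) huv
          have h3 := (hsp i S hS).1 u hu v hv huv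
          linarith [h3.1, h3.2]
        · rw [abs_sub_comm]
          have := hedge v u huv.symm i S t hS hv
          rw [W.w_symm] at this
          linarith
      · have := hedge u v huv i S t hS hu
        linarith
    · simp only [F, hS, if_false, sub_self, abs_zero]
      linarith
  · intro u
    choose B hB hB0 using coordFn_support
    let c : Fin (k + 1) → Set V := fun i =>
      if h : ∃ S ∈ D.X i, u ∈ S then h.choose else ∅
    have hc : ∀ i S, S ∈ D.X i → u ∈ S → S = c i := by
      intro i S hS huS
      have h : ∃ S ∈ D.X i, u ∈ S := ⟨S, hS, huS⟩
      simp only [c, h, dif_pos]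
      by_contra hne
      exact Set.disjoint_left.mp (D.partialPartition i S hS _ h.choose_spec.1 hne) huS
        h.choose_spec.2
    refine ⟨Finset.univ.biUnion fun i : Fin (k + 1) =>
      (B (rhoFn W R (c i) u) (s i (c i) u) (pos i (c i) u)).image fun t => (i, c i, t), ?_, ?_⟩
    · refine (Finset.card_biUnion_le_card_mul _ _ 8 ?_).trans (by simp)
      intro i _
      exact Finset.card_image_le.trans (hB _ _ _)
    · rintro ⟨i, S, t⟩ ha
      by_cases hS : S ∈ D.X i
      · by_cases hu : u ∈ S
        · obtain rfl := hc i S hS hu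
          rw [hFin u i _ t hS]
          apply hB0
          intro ht
          apply ha
          simp only [Finset.mem_biUnion, Finset.mem_univ, true_and, Finset.mem_image]
          exact ⟨i, t, ht, rfl⟩
        · exact hF0 u i S t hu
      · simp only [F, hS, if_false]
  · -- lower bound
    have hsep : ∀ u v δ (i : Fin (k + 1)) S, δ < R → S ∈ D.X i → u ∈ S → v ∉ S →
        (∀ b ∈ D.below i, δ < W.dist u b) → ∃ a, δ ≤ |F u a - F v a| := by
      intro u v δ i S hδ hS hu hv hb
      refine ⟨(i, S, none), ?_⟩
      rw [hF0 v i S _ hv, hFin u i S _ hS, sub_zero]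
      have : δ < rhoFn W R S u := lt_rhoFn hδ fun z hz => D.dist_outside i hS hu hz hb
      exact this.le.trans (le_abs_self _)
    -- the main case, where `u` is the vertex close to the path
    have hmain : ∀ u v δ (i : Fin k), 0 < δ → W.dist u v = 12 * δ →
        (∀ b ∈ D.below i.castSucc, δ < W.dist u b) →
        (∀ b ∈ D.below i.castSucc, δ < W.dist v b) →
        (∃ S ∈ D.X i.castSucc, ∃ b ∈ D.pathOf i S, W.dist u b ≤ δ) →
        ∃ a, δ / 16 ≤ |F u a - F v a| := by
      rintro u v δ i hδ huv hbu hbv ⟨S', hS', b, hb, hub⟩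
      have hδR : δ < R := by linarith [hR u v]
      obtain ⟨S, hS, hu⟩ := D.exists_cluster i.castSucc u
        fun h => absurd (hbu u h) (by rw [W.dist_self']; exact not_lt.mpr hδ.le)
      by_cases hv : v ∈ S
      swap
      · obtain ⟨a, ha⟩ := hsep u v δ _ S hδR hS hu hv hbu
        exact ⟨a, by linarith⟩
      have hou : ∀ z ∉ S, δ < W.dist u z := fun z hz => D.dist_outside _ hS hu hz hbu
      have hov : ∀ z ∉ S, δ < W.dist v z := fun z hz => D.dist_outside _ hS hv hz hbv
      have hru : δ < rhoFn W R S u := lt_rhoFn hδR hou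
      have hrv : δ < rhoFn W R S v := lt_rhoFn hδR hov
      have hbS : b ∈ S := by
        by_contra hbS
        exact absurd (hou b hbS) (not_lt.mpr hub)
      have hSS : S' = S := by
        by_contra hne
        exact Set.disjoint_left.mp (D.partialPartition _ S' hS' S hS hne)
          (D.path_subset i S' hS' hb) hbS
      subst hSS
      obtain ⟨-, hp⟩ := hsp _ _ hS
      obtain ⟨hp1, hp2⟩ := hp i rfl
      -- distance to the path inside the cluster
      obtain ⟨η, hη, hηd⟩ : ∃ η, δ < η ∧ ∀ z ∉ S', η ≤ W.dist u z := by
        refine ⟨rhoFn W R S' u, hru, fun z hz => ?_⟩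
        have := ciInf_le (Set.finite_range (fun z => if z ∈ S' then R else W.dist u z)).bddBelow z
        simp only [hz, if_false] at this
        exact this
      have hsu : s i.castSucc S' u ≤ δ := by
        apply le_of_forall_gt_imp_ge_of_dense
        intro c hc
        have : W.dist u b < min c η := lt_min (hub.trans_lt hc) (hub.trans_lt hη)
        obtain ⟨p, hpw⟩ := exists_walk_lt W.pre this
        refine (hp1 u hu b hb p ?_).trans (hpw.le.trans (min_le_left _ _))
        intro x hx
        by_contra hxS
        have h1 := wdist_le_of_mem_support W.w_pos p hx
        have h2 := hηd x hxS
        have h3 := hpw.trans_le (min_le_right _ _)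
        exact absurd (h2.trans h1) (not_le.mpr h3)
      have hpp := hp2 u hu v hv
      rw [huv] at hpp
      obtain ⟨t, ht⟩ := coordFn_lower hδ hru hrv hsu hpp
      refine ⟨(i.castSucc, S', t), ?_⟩
      rw [hFin u _ _ t hS, hFin v _ _ t hS]
      exact ht
    intro u v hpos hcond
    obtain ⟨δ, hδ⟩ : ∃ δ, W.dist u v = 12 * δ := ⟨W.dist u v / 12, by ring⟩
    have hδ0 : 0 < δ := by linarith
    have hδR : δ < R := by linarith [hR u v]
    let close : ℕ → Prop := fun n => ∃ i : Fin k, i.val = n ∧ ∃ S ∈ D.X i.castSucc,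
      ∃ b ∈ D.pathOf i S, W.dist v b ≤ δ ∨ W.dist u b ≤ δ
    by_cases hcl : ∃ n, close n
    · obtain ⟨i, hi, S, hS, b, hb, hd⟩ := Nat.find_spec hcl
      have hmin : ∀ b ∈ D.below i.castSucc, δ < W.dist v b ∧ δ < W.dist u b := by
        rintro b ⟨j, hj, S, hS, hb⟩
        have hj' : j.val < Nat.find hcl := by rw [← hi]; exact hj
        have := Nat.find_min hcl hj'
        by_contra hcon
        apply this
        refine ⟨j, rfl, S, hS, b, hb, ?_⟩
        by_contra h
        push Not at h
        exact hcon h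
      rcases hd with hd | hd
      · obtain ⟨a, ha⟩ := hmain v u δ i hδ0 (by rw [W.dist_comm', hδ]) (fun b hb => (hmin b hb).1)
          (fun b hb => (hmin b hb).2) ⟨S, hS, b, hb, hd⟩
        exact ⟨a, by rw [abs_sub_comm, hδ]; linarith⟩
      · obtain ⟨a, ha⟩ := hmain u v δ i hδ0 hδ (fun b hb => (hmin b hb).2)
          (fun b hb => (hmin b hb).1) ⟨S, hS, b, hb, hd⟩
        exact ⟨a, by rw [hδ]; linarith⟩
    · have hdiv : W.dist u v / 12 = δ := by rw [hδ]; ring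
      rw [hdiv] at hcond
      have hfar : ∀ b ∈ D.below (Fin.last k), δ < W.dist u b := by
        rintro b ⟨j, hj, S, hS, hb⟩
        by_contra h
        exact hcl ⟨_, j, rfl, S, hS, b, hb, Or.inr (not_lt.mp h)⟩
      rcases hcond with hcond | ⟨b, hb, hd⟩
      · obtain ⟨S, hS, hu⟩ := D.exists_cluster (Fin.last k) u
          fun h => absurd (hfar u h) (by rw [W.dist_self']; exact not_lt.mpr hδ0.le)
        have hv : v ∉ S := fun hv => hcond ⟨S, hS, hu, hv⟩
        obtain ⟨a, ha⟩ := hsep u v δ _ S hδR hS hu hv hfar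
        exact ⟨a, by rw [hδ]; linarith⟩
      · exfalso
        simp only [PSPD.boundary, Set.mem_iUnion] at hb
        obtain ⟨i, S, hS, hb⟩ := hb
        exact hcl ⟨_, i, rfl, S, hS, b, hb, hd⟩

/-- There is a universal constant `C > 0` such that for every finite connected weighted
graph `W` and every PSPD of depth `k` of `W` with remainder `(𝒞, ℬ)`, there is an
embedding `f : V → ℓ₁` which is `C·√k`-Lipschitz, and non-contractive on every pair
`u, v` that is either separated by `𝒞` or satisfies
`min {d_G(v,ℬ), d_G(u,ℬ)} ≤ d_G(u,v)/12`. -/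
theorem pspd_embedding :
    ∃ C : ℝ, 0 < C ∧
      ∀ (V : Type) (_ : Fintype V) (W : WeightedGraph V) (k : ℕ) (D : PSPD W k),
        ∃ f : V → ℓ1,
          (∀ u v : V, ‖f v - f u‖ ≤ C * Real.sqrt k * W.dist u v) ∧
          (∀ u v : V,
            ((¬ ∃ S ∈ D.lastClusters, u ∈ S ∧ v ∈ S) ∨
              (∃ b ∈ D.boundary,
                W.dist v b ≤ W.dist u v / 12 ∨ W.dist u b ≤ W.dist u v / 12)) →
            W.dist u v ≤ ‖f v - f u‖) := by
  refine ⟨192 * 51, by norm_num, ?_⟩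
  intro V _ W k D
  classical
  rcases Nat.eq_zero_or_pos k with rfl | hk
  · refine ⟨fun _ => 0, by simp, ?_⟩
    rintro u v (h | ⟨b, hb, _⟩)
    · exfalso
      apply h
      refine ⟨Set.univ, ?_, trivial, trivial⟩
      have : D.X 0 = {Set.univ} := D.X_zero
      change Set.univ ∈ D.X 0
      rw [this]; rfl
    · simp [PSPD.boundary] at hb
  obtain ⟨ι, F, hlip, hsupp, hlow⟩ := D.core
  have hk1 : (1:ℝ) ≤ k := by exact_mod_cast hk
  -- choose finitely many coordinates
  have hex : ∀ x : V × V, ∃ A : Finset ι, (∃ a, W.dist x.1 x.2 / 192 ≤ |F x.1 a - F x.2 a|) →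
      ∃ a ∈ A, W.dist x.1 x.2 / 192 ≤ |F x.1 a - F x.2 a| := by
    intro x
    by_cases h : ∃ a, W.dist x.1 x.2 / 192 ≤ |F x.1 a - F x.2 a|
    · obtain ⟨a, ha⟩ := h
      exact ⟨{a}, fun _ => ⟨a, by simp, ha⟩⟩
    · exact ⟨∅, fun h' => absurd h' h⟩
  choose A0 hA0 using hex
  let A : Finset ι := Finset.univ.biUnion A0
  obtain ⟨g, hg1, hg2⟩ := embed_l1 F A
  have hgedge : ∀ u v, W.G.Adj u v → ‖g v - g u‖ ≤ 51 * Real.sqrt k * W.w u v := by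
    intro u v huv
    have hw := W.w_pos u v huv
    obtain ⟨B, hB, hB0⟩ := hsupp u
    obtain ⟨B', hB', hB0'⟩ := hsupp v
    have hsum : ∑ a ∈ A, (F v a - F u a) ^ 2 ≤ ((k + 1) * 16) * (3 * W.w u v) ^ 2 := by
      calc ∑ a ∈ A, (F v a - F u a) ^ 2 ≤ ∑ a ∈ A ∪ (B ∪ B'), (F v a - F u a) ^ 2 :=
            Finset.sum_le_sum_of_subset_of_nonneg Finset.subset_union_left
              fun _ _ _ => sq_nonneg _
        _ = ∑ a ∈ B ∪ B', (F v a - F u a) ^ 2 := by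
            symm
            apply Finset.sum_subset Finset.subset_union_right
            intro a _ ha
            simp only [Finset.mem_union, not_or] at ha
            rw [hB0 a ha.1, hB0' a ha.2]; simp
        _ ≤ ∑ a ∈ B ∪ B', (3 * W.w u v) ^ 2 := by
            apply Finset.sum_le_sum
            intro a _
            rw [sq_le_sq, abs_of_pos (by positivity : 0 < 3 * W.w u v), abs_sub_comm]
            exact hlip u v huv a
        _ = ((B ∪ B').card : ℝ) * (3 * W.w u v) ^ 2 := by simp
        _ ≤ ((k + 1) * 16) * (3 * W.w u v) ^ 2 := by
            have : (B ∪ B').card ≤ (k + 1) * 16 := by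
              have := Finset.card_union_le B B'
              omega
            have : ((B ∪ B').card : ℝ) ≤ (k + 1) * 16 := by exact_mod_cast this
            gcongr
    apply le_of_sq_le_sq _ (by positivity)
    refine (hg1 u v).trans (hsum.trans ?_)
    rw [mul_pow, mul_pow, mul_pow, Real.sq_sqrt (by positivity)]
    nlinarith [sq_nonneg (W.w u v), mul_nonneg (sub_nonneg.mpr hk1) (sq_nonneg (W.w u v))]
  have hsq : 0 < Real.sqrt k := Real.sqrt_pos.mpr (by linarith)
  refine ⟨fun v => (192:ℝ) • g v, ?_, ?_⟩
  · intro u v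
    refine lipschitz_of_edges (w := W.w) W.pre (fun v => (192:ℝ) • g v) (192 * 51 * Real.sqrt k)
      (by positivity) (fun u v huv => ?_) u v
    rw [← smul_sub, norm_smul, Real.norm_of_nonneg (by norm_num)]
    linarith [hgedge u v huv]
  · intro u v hcond
    rw [← smul_sub, norm_smul, Real.norm_of_nonneg (by norm_num)]
    rcases (W.dist_nonneg' u v).lt_or_eq with hpos | h0
    · obtain ⟨a, ha, hle⟩ := hA0 (u, v) (hlow u v hpos hcond)
      have := hg2 u v a (Finset.mem_biUnion.mpr ⟨(u, v), Finset.mem_univ _, ha⟩)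
      rw [abs_sub_comm] at this
      simp only at hle
      linarith
    · rw [← h0]; positivity
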